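/- Let f : ℝ → ℝ be twice continuously differentiable with f′ and f″ bounded. Then ψ is twice differentiable on (0, q̲) with ψ′(t) = α·E[f′(√t·Z + √(q̲−t)·Z′)·f′(√t·Z + √(q̲−t)·Z″)] and ψ″(t) = α·E[f″(√t·Z + √(q̲−t)·Z′)·f″(√t·Z + √(q̲−t)·Z″)]; moreover ψ′(t) ≥ 0 and ψ″(t) ≥ 0 for all t ∈ (0, q̲), so ψ is non-decreasing and convex on [0, q̲]. (Part of Lemma 3.3.) -/

import Mathlib

open MeasureTheory ProbabilityTheory

/-- The standard Gaussian measure on `ℝ`. -/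
noncomputable def stdGauss : Measure ℝ := gaussianReal 0 1

/-- `ψ(t) = α·E[f(√t·Z + √(q̲−t)·Z′)·f(√t·Z + √(q̲−t)·Z″)]`, where `Z, Z′, Z″` are
i.i.d. standard Gaussians (realized as the three coordinates of the product measure). -/
noncomputable def psi (qlow α : ℝ) (f : ℝ → ℝ) (t : ℝ) : ℝ :=
  α * ∫ w : ℝ × ℝ × ℝ,
        f (Real.sqrt t * w.1 + Real.sqrt (qlow - t) * w.2.1) *
          f (Real.sqrt t * w.1 + Real.sqrt (qlow - t) * w.2.2)
      ∂(stdGauss.prod (stdGauss.prod stdGauss))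

instance isProbabilityMeasure_stdGauss : IsProbabilityMeasure stdGauss := by
  unfold stdGauss; infer_instance

instance isGaussian_stdGauss : IsGaussian stdGauss := by
  unfold stdGauss; infer_instance

/-- The joint law of three independent standard Gaussian variables. -/
noncomputable abbrev stdGauss₃ : Measure (ℝ × ℝ × ℝ) :=
  stdGauss.prod (stdGauss.prod stdGauss)

lemma memLp_id_stdGauss : MemLp (fun x : ℝ => x) 2 stdGauss :=
  memLp_id_gaussianReal' 2 (by simp)

lemma integrable_stdGauss_iff {f : ℝ → ℝ} :
    Integrable f stdGauss ↔ Integrable (fun x => gaussianPDFReal 0 1 x * f x) := by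
  rw [stdGauss, gaussianReal_of_var_ne_zero 0 one_ne_zero,
    integrable_withDensity_iff_integrable_smul' (measurable_gaussianPDF _ _)
      (ae_of_all _ fun _ => gaussianPDF_lt_top)]
  simp [toReal_gaussianPDF]

lemma hasDerivAt_gaussianPDFReal_zero_one (x : ℝ) :
    HasDerivAt (gaussianPDFReal 0 1) (-(x * gaussianPDFReal 0 1 x)) x := by
  have hpdf : gaussianPDFReal 0 1 = fun y => (√(2 * Real.pi))⁻¹ * Real.exp (-y ^ 2 / 2) := by
    ext y; simp [gaussianPDFReal]
  have h : HasDerivAt (fun y : ℝ => -y ^ 2 / 2) (-x) x := by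
    refine (((hasDerivAt_id' x).fun_pow 2).fun_neg.div_const 2).congr_deriv ?_
    norm_num
    ring
  rw [hpdf]
  refine (h.exp.const_mul _).congr_deriv ?_
  ring

/-- Gaussian integration by parts (Stein's identity). -/
lemma integral_mul_stdGauss_eq_integral_deriv {h h' : ℝ → ℝ} (hd : ∀ x, HasDerivAt h (h' x) x)
    (hi : Integrable h stdGauss) (hi' : Integrable h' stdGauss)
    (hxi : Integrable (fun x => x * h x) stdGauss) :
    ∫ x, x * h x ∂stdGauss = ∫ x, h' x ∂stdGauss := by
  rw [integrable_stdGauss_iff] at hi hi' hxi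
  have key := integral_mul_deriv_eq_deriv_mul_of_integrable (u := h) (v := gaussianPDFReal 0 1)
    (u' := h') (v' := fun x => -(x * gaussianPDFReal 0 1 x)) (fun x _ => hd x)
    (fun x _ => hasDerivAt_gaussianPDFReal_zero_one x)
    (by convert hxi.neg using 1; ext x; simp; ring)
    (by convert hi' using 1; ext x; simp; ring)
    (by convert hi using 1; ext x; simp; ring)
  simp only [stdGauss, integral_gaussianReal_eq_integral_smul (one_ne_zero : (1 : NNReal) ≠ 0),
    smul_eq_mul]
  have e1 : (fun x => h x * -(x * gaussianPDFReal 0 1 x)) =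
      fun x => -(gaussianPDFReal 0 1 x * (x * h x)) := by ext x; ring
  rw [e1, integral_neg, neg_inj] at key
  rw [key]
  exact integral_congr_ae (ae_of_all _ fun x => mul_comm _ _)

/-- The coordinate weight dominating functions of linear growth on `ℝ × ℝ × ℝ`. -/
def linearWeight (w : ℝ × ℝ × ℝ) : ℝ := 1 + |w.1| + |w.2.1| + |w.2.2|

lemma one_le_linearWeight (w : ℝ × ℝ × ℝ) : 1 ≤ linearWeight w := by
  have := abs_nonneg w.1
  have := abs_nonneg w.2.1
  have := abs_nonneg w.2.2
  unfold linearWeight; linarith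

lemma integrable_linearWeight_sq : Integrable (fun w => linearWeight w ^ 2) stdGauss₃ := by
  have h1 : MemLp (fun w : ℝ × ℝ × ℝ => w.1) 2 stdGauss₃ :=
    memLp_id_stdGauss.comp_measurePreserving measurePreserving_fst
  have h2 : MemLp (fun w : ℝ × ℝ × ℝ => w.2.1) 2 stdGauss₃ :=
    memLp_id_stdGauss.comp_measurePreserving (measurePreserving_fst.comp measurePreserving_snd)
  have h3 : MemLp (fun w : ℝ × ℝ × ℝ => w.2.2) 2 stdGauss₃ :=
    memLp_id_stdGauss.comp_measurePreserving (measurePreserving_snd.comp measurePreserving_snd)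
  have h0 : MemLp (fun _ : ℝ × ℝ × ℝ => (1 : ℝ)) 2 stdGauss₃ := memLp_const 1
  have h : MemLp linearWeight 2 stdGauss₃ := ((h0.add h1.norm).add h2.norm).add h3.norm
  exact h.integrable_sq

lemma integrable_of_le_linearWeight_sq {F : ℝ × ℝ × ℝ → ℝ} (hF : Continuous F) (M : ℝ)
    (hM : ∀ w, |F w| ≤ M * linearWeight w ^ 2) : Integrable F stdGauss₃ :=
  (integrable_linearWeight_sq.const_mul M).mono' hF.aestronglyMeasurable (ae_of_all _ hM)

lemma abs_mul_add_mul_fst_le (a b : ℝ) (w : ℝ × ℝ × ℝ) :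
    |a * w.1 + b * w.2.1| ≤ (|a| + |b|) * linearWeight w := by
  have := abs_add_le (a * w.1) (b * w.2.1)
  rw [abs_mul, abs_mul] at this
  have h1 := abs_nonneg w.1
  have h2 := abs_nonneg w.2.1
  have h3 := abs_nonneg w.2.2
  unfold linearWeight
  nlinarith [abs_nonneg a, abs_nonneg b, mul_nonneg (abs_nonneg a) h2,
    mul_nonneg (abs_nonneg a) h3, mul_nonneg (abs_nonneg b) h1, mul_nonneg (abs_nonneg b) h3]

lemma abs_mul_add_mul_snd_le (a b : ℝ) (w : ℝ × ℝ × ℝ) :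
    |a * w.1 + b * w.2.2| ≤ (|a| + |b|) * linearWeight w := by
  convert abs_mul_add_mul_fst_le a b (w.1, w.2.2, w.2.1) using 2
  unfold linearWeight; ring

lemma exists_linear_growth {g : ℝ → ℝ} (hg : Differentiable ℝ g)
    (hg' : ∃ C, ∀ x, |deriv g x| ≤ C) :
    ∃ K, 0 ≤ K ∧ (∀ x, |g x| ≤ K * (1 + |x|)) ∧ ∀ x, |deriv g x| ≤ K := by
  obtain ⟨C, hC⟩ := hg'
  have hC0 : 0 ≤ C := (abs_nonneg _).trans (hC 0)
  refine ⟨|g 0| + C, by positivity, fun x => ?_, fun x => (hC x).trans (by simp)⟩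
  have h := Convex.norm_image_sub_le_of_norm_deriv_le (f := g) (C := C) (s := Set.univ)
    (fun y _ => hg y) (fun y _ => hC y) convex_univ (Set.mem_univ 0) (Set.mem_univ x)
  simp only [Real.norm_eq_abs, sub_zero] at h
  have h2 := abs_sub_abs_le_abs_sub (g x) (g 0)
  nlinarith [abs_nonneg x, abs_nonneg (g 0), mul_nonneg (abs_nonneg x) (abs_nonneg (g 0))]

lemma MeasureTheory.MeasurePreserving.integral_comp_of_continuous {T : ℝ × ℝ × ℝ → ℝ × ℝ × ℝ}
    (hT : MeasurePreserving T stdGauss₃ stdGauss₃) {H : ℝ × ℝ × ℝ → ℝ} (hH : Continuous H) :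
    ∫ w, H (T w) ∂stdGauss₃ = ∫ w, H w ∂stdGauss₃ := by
  conv_rhs => rw [← hT.map_eq]
  exact (integral_map hT.measurable.aemeasurable hH.aestronglyMeasurable).symm

lemma measurePreserving_rotation {c s : ℝ} (hcs : c ^ 2 + s ^ 2 = 1) :
    MeasurePreserving
      (fun w : ℝ × ℝ × ℝ => (c * w.1 - s * w.2.1, s * w.1 + c * w.2.1, w.2.2))
      stdGauss₃ stdGauss₃ := by
  obtain ⟨θ, hc, hs⟩ : ∃ θ, Real.cos θ = c ∧ Real.sin θ = -s := by
    have hn : ‖(⟨c, -s⟩ : ℂ)‖ = 1 := by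
      rw [Complex.norm_def, Complex.normSq_mk, show c * c + -s * -s = 1 by linarith, Real.sqrt_one]
    have h0 : (⟨c, -s⟩ : ℂ) ≠ 0 := by
      intro h; rw [h] at hn; simp at hn
    exact ⟨Complex.arg ⟨c, -s⟩, by rw [Complex.cos_arg h0, hn]; simp,
      by rw [Complex.sin_arg, hn]; simp⟩
  have hrot : MeasurePreserving (ContinuousLinearMap.rotation (E := ℝ) θ)
      (stdGauss.prod stdGauss) (stdGauss.prod stdGauss) := by
    refine ⟨by fun_prop, IsGaussian.map_rotation_eq_self ?_ θ⟩
    simp [stdGauss]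
  have hassoc := measurePreserving_prodAssoc stdGauss stdGauss stdGauss
  have h := hassoc.comp ((hrot.prod (MeasurePreserving.id stdGauss)).comp
    (hassoc.symm MeasurableEquiv.prodAssoc))
  convert h using 1
  ext w <;> simp [ContinuousLinearMap.rotation_apply, hc, hs, MeasurableEquiv.prodAssoc]; ring

lemma measurePreserving_swap_snd :
    MeasurePreserving (fun w : ℝ × ℝ × ℝ => (w.1, w.2.2, w.2.1)) stdGauss₃ stdGauss₃ :=
  (MeasurePreserving.id stdGauss).prod (Measure.measurePreserving_swap)

lemma integral_congr_of_integral_middle {F G : ℝ × ℝ × ℝ → ℝ} (hF : Integrable F stdGauss₃)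
    (hG : Integrable G stdGauss₃)
    (h : ∀ u w, ∫ v, F (u, v, w) ∂stdGauss = ∫ v, G (u, v, w) ∂stdGauss) :
    ∫ x, F x ∂stdGauss₃ = ∫ x, G x ∂stdGauss₃ := by
  rw [integral_prod _ hF, integral_prod _ hG]
  refine integral_congr_ae ?_
  filter_upwards [hF.prod_right_ae, hG.prod_right_ae] with u hu hu'
  rw [integral_prod_symm _ hu, integral_prod_symm _ hu']
  simp only [h]

lemma abs_comp_le_linearWeight {g : ℝ → ℝ} {K m x : ℝ} {w : ℝ × ℝ × ℝ} (hK : 0 ≤ K)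
    (hg : ∀ x, |g x| ≤ K * (1 + |x|)) (hx : |x| ≤ m * linearWeight w) :
    |g x| ≤ K * (1 + m) * linearWeight w := by
  have h := hg x
  have h1 := one_le_linearWeight w
  have h2 : K * (1 + |x|) ≤ K * ((1 + m) * linearWeight w) :=
    mul_le_mul_of_nonneg_left (by linarith) hK
  linarith

/-- Gaussian integration by parts in a direction along which `a * w.1 + b * w.2.1` is constant. -/
lemma integral_directional_by_parts {g : ℝ → ℝ} (hg : ContDiff ℝ 1 g)
    (hg' : ∃ C, ∀ x, |deriv g x| ≤ C) {a b : ℝ} (ha : 0 < a) (hb : 0 < b) :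
    ∫ w, (w.1 / a - w.2.1 / b) *
        (deriv g (a * w.1 + b * w.2.1) * g (a * w.1 + b * w.2.2)) ∂stdGauss₃ =
      ∫ w, deriv g (a * w.1 + b * w.2.1) * deriv g (a * w.1 + b * w.2.2) ∂stdGauss₃ := by
  have hgd : Differentiable ℝ g := hg.differentiable one_ne_zero
  have hgc : Continuous g := hg.continuous
  have hgc' : Continuous (deriv g) := hg.continuous_deriv le_rfl
  obtain ⟨K, hK, hgK, hgK'⟩ := exists_linear_growth hgd hg'
  set r := √(a ^ 2 + b ^ 2) with hr
  have hr0 : 0 < r := Real.sqrt_pos.2 (by positivity)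
  have hr2 : r ^ 2 = a ^ 2 + b ^ 2 := Real.sq_sqrt (by positivity)
  have hrot := measurePreserving_rotation (c := a / r) (s := b / r)
    (by field_simp; linarith)
  set F : ℝ × ℝ × ℝ → ℝ := fun w => (w.1 / a - w.2.1 / b) *
        (deriv g (a * w.1 + b * w.2.1) * g (a * w.1 + b * w.2.2)) with hF
  set G : ℝ × ℝ × ℝ → ℝ := fun w =>
    deriv g (a * w.1 + b * w.2.1) * deriv g (a * w.1 + b * w.2.2) with hG
  have hFc : Continuous F := by fun_prop
  have hGc : Continuous G := by fun_prop
  have hFi : Integrable F stdGauss₃ := by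
    refine integrable_of_le_linearWeight_sq hFc
      ((|1 / a| + |-(1 / b)|) * (K * (K * (1 + (|a| + |b|))))) fun w => ?_
    have hw := one_le_linearWeight w
    have h1 := abs_mul_add_mul_fst_le (1 / a) (-(1 / b)) w
    have h2 := hgK' (a * w.1 + b * w.2.1)
    have h3 := abs_comp_le_linearWeight hK hgK (abs_mul_add_mul_snd_le a b w)
    have e : w.1 / a - w.2.1 / b = 1 / a * w.1 + -(1 / b) * w.2.1 := by ring
    rw [hF]
    simp only
    rw [e, abs_mul, abs_mul]
    calc _ ≤ ((|1 / a| + |-(1 / b)|) * linearWeight w) *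
          (K * (K * (1 + (|a| + |b|)) * linearWeight w)) := by gcongr
      _ = _ := by ring
  have hGi : Integrable G stdGauss₃ := by
    refine integrable_of_le_linearWeight_sq hGc (K * K) fun w => ?_
    have hw := one_le_linearWeight w
    have h1 := hgK' (a * w.1 + b * w.2.1)
    have h2 := hgK' (a * w.1 + b * w.2.2)
    rw [hG]
    simp only
    rw [abs_mul]
    calc _ ≤ K * K := by gcongr
      _ ≤ _ := le_mul_of_one_le_right (by positivity) (one_le_pow₀ hw)
  rw [← hrot.integral_comp_of_continuous hFc, ← hrot.integral_comp_of_continuous hGc]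
  refine integral_congr_of_integral_middle (hrot.integrable_comp_of_integrable hFi)
    (hrot.integrable_comp_of_integrable hGi) fun u w => ?_
  set p := a * (a / r * u) + b * w with hp
  set κ := -(a * b / r) with hκ
  have hκ0 : κ ≠ 0 := by rw [hκ]; exact neg_ne_zero.2 (by positivity)
  have e1 (v : ℝ) : a * (a / r * u - b / r * v) + b * (b / r * u + a / r * v) = r * u := by
    field_simp; rw [hr2]; ring
  have e2 (v : ℝ) : a * (a / r * u - b / r * v) + b * w = p + κ * v := by
    rw [hp, hκ]; ring
  have e3 (v : ℝ) : (a / r * u - b / r * v) / a - (b / r * u + a / r * v) / b = κ⁻¹ * v := by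
    rw [hκ]; field_simp; rw [hr2]; ring
  simp only [hF, hG, e1, e2, e3]
  have hid : MemLp (fun x : ℝ => x) 2 stdGauss := memLp_id_stdGauss
  have hh : MemLp (fun v => g (p + κ * v)) 2 stdGauss := by
    have hm : MemLp (fun v : ℝ => K * (1 + |p| + |κ| * |v|)) 2 stdGauss :=
      ((memLp_const (1 + |p|)).add (hid.norm.const_mul |κ|)).const_mul K
    refine hm.mono' (by fun_prop) (ae_of_all _ fun v => (hgK _).trans ?_)
    have h1 := abs_add_le p (κ * v)
    rw [abs_mul] at h1
    exact mul_le_mul_of_nonneg_left (by linarith) hK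
  have hh' : Integrable (fun v => κ * deriv g (p + κ * v)) stdGauss := by
    refine (integrable_const (|κ| * K)).mono' (by fun_prop) (ae_of_all _ fun v => ?_)
    rw [Real.norm_eq_abs, abs_mul]
    gcongr
    exact hgK' _
  have hd (v : ℝ) : HasDerivAt (fun v => g (p + κ * v)) (κ * deriv g (p + κ * v)) v := by
    have h1 : HasDerivAt (fun v => p + κ * v) κ v := by
      simpa using ((hasDerivAt_id' v).const_mul κ).const_add p
    exact ((hgd _).hasDerivAt.comp v h1).congr_deriv (mul_comm _ _)
  have key := integral_mul_stdGauss_eq_integral_deriv hd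
    (hh.integrable (by norm_num)) hh' (hid.integrable_mul hh)
  rw [integral_const_mul] at key
  calc _ = ∫ v, (κ⁻¹ * deriv g (r * u)) * (v * g (p + κ * v)) ∂stdGauss := by
        congr 1; ext v; ring
    _ = deriv g (r * u) * ∫ v, deriv g (p + κ * v) ∂stdGauss := by
        rw [integral_const_mul, key]; field_simp
    _ = _ := (integral_const_mul _ _).symm

lemma psi_nonneg {q α : ℝ} (hα : 0 ≤ α) {g : ℝ → ℝ} (hg : Continuous g)
    (hb : ∃ C, ∀ x, |g x| ≤ C) (t : ℝ) : 0 ≤ psi q α g t := by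
  obtain ⟨C, hC⟩ := hb
  have hC0 : 0 ≤ C := (abs_nonneg _).trans (hC 0)
  have hi : Integrable (fun w : ℝ × ℝ × ℝ => g (√t * w.1 + √(q - t) * w.2.1) *
      g (√t * w.1 + √(q - t) * w.2.2)) stdGauss₃ := by
    refine (integrable_const (C * C)).mono' (by fun_prop) (ae_of_all _ fun w => ?_)
    rw [Real.norm_eq_abs, abs_mul]
    exact mul_le_mul (hC _) (hC _) (abs_nonneg _) hC0
  unfold psi
  refine mul_nonneg hα ?_
  rw [integral_prod _ hi]
  refine integral_nonneg fun z => ?_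
  simp only
  rw [integral_prod_mul (fun x => g (√t * z + √(q - t) * x)) (fun x => g (√t * z + √(q - t) * x))]
  exact mul_self_nonneg _

lemma psi_continuousOn {q α : ℝ} {g : ℝ → ℝ} (hg : Differentiable ℝ g)
    (hg' : ∃ C, ∀ x, |deriv g x| ≤ C) : ContinuousOn (psi q α g) (Set.Icc 0 q) := by
  obtain ⟨K, hK, hgK, -⟩ := exists_linear_growth hg hg'
  have hgc := hg.continuous
  unfold psi
  refine continuousOn_const.mul ?_
  refine continuousOn_of_dominated
    (bound := fun w => (K * (1 + (√q + √q))) * (K * (1 + (√q + √q))) * linearWeight w ^ 2)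
    (fun t _ => (by fun_prop : Continuous _).aestronglyMeasurable) (fun t ht => ?_)
    (integrable_linearWeight_sq.const_mul _) (ae_of_all _ fun w => by fun_prop)
  refine ae_of_all _ fun w => ?_
  have hw := one_le_linearWeight w
  have hm : |√t| + |√(q - t)| ≤ √q + √q := by
    rw [abs_of_nonneg (Real.sqrt_nonneg _), abs_of_nonneg (Real.sqrt_nonneg _)]
    exact add_le_add (Real.sqrt_le_sqrt ht.2) (Real.sqrt_le_sqrt (by linarith [ht.1]))
  have h1 := abs_comp_le_linearWeight hK hgK
    ((abs_mul_add_mul_fst_le (√t) (√(q - t)) w).trans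
      (mul_le_mul_of_nonneg_right hm (by linarith)))
  have h2 := abs_comp_le_linearWeight hK hgK
    ((abs_mul_add_mul_snd_le (√t) (√(q - t)) w).trans
      (mul_le_mul_of_nonneg_right hm (by linarith)))
  rw [Real.norm_eq_abs, abs_mul]
  calc _ ≤ (K * (1 + (√q + √q)) * linearWeight w) * (K * (1 + (√q + √q)) * linearWeight w) := by
        gcongr
    _ = _ := by ring

lemma hasDerivAt_sqrt_mul_add_sqrt_sub_mul {q t : ℝ} (ht : t ∈ Set.Ioo 0 q) (x y : ℝ) :
    HasDerivAt (fun s => √s * x + √(q - s) * y) ((x / √t - y / √(q - t)) / 2) t := by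
  have h1 := (Real.hasDerivAt_sqrt ht.1.ne').mul_const x
  have h2 := (((hasDerivAt_id' t).const_sub q).sqrt (sub_pos.2 ht.2).ne').mul_const y
  refine (h1.add h2).congr_deriv ?_
  ring

lemma psi_hasDerivAt {q α : ℝ} {g : ℝ → ℝ} (hg : ContDiff ℝ 1 g)
    (hg' : ∃ C, ∀ x, |deriv g x| ≤ C) {t : ℝ} (ht : t ∈ Set.Ioo 0 q) :
    HasDerivAt (psi q α g) (psi q α (deriv g) t) t := by
  have hgd : Differentiable ℝ g := hg.differentiable one_ne_zero
  have hgc : Continuous g := hg.continuous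
  have hgc' : Continuous (deriv g) := hg.continuous_deriv le_rfl
  have hparts := integral_directional_by_parts hg hg' (Real.sqrt_pos.2 ht.1)
    (Real.sqrt_pos.2 (sub_pos.2 ht.2))
  obtain ⟨K, hK, hgK, hgK'⟩ := exists_linear_growth hgd hg'
  set P : ℝ → ℝ × ℝ × ℝ → ℝ := fun s w => (w.1 / √s - w.2.1 / √(q - s)) *
    (deriv g (√s * w.1 + √(q - s) * w.2.1) * g (√s * w.1 + √(q - s) * w.2.2)) with hP
  have hPc (s : ℝ) : Continuous (P s) := by fun_prop
  set T : ℝ × ℝ × ℝ → ℝ × ℝ × ℝ := fun w => (w.1, w.2.2, w.2.1) with hT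
  have hTc : Continuous T := by fun_prop
  have hTP := measurePreserving_swap_snd.integral_comp_of_continuous (hPc t)
  set δ := √(min (t / 2) ((q - t) / 2)) with hδ
  have hδ0 : 0 < δ := Real.sqrt_pos.2 (lt_min (by linarith [ht.1]) (by linarith [ht.2]))
  set M := (|1 / δ| + |1 / δ|) * (K * (K * (1 + (√q + √q)))) with hM
  have hbound (s : ℝ) (hs : s ∈ Set.Ioo (t / 2) ((t + q) / 2)) (w : ℝ × ℝ × ℝ) :
      |P s w| ≤ M * linearWeight w ^ 2 := by
    have hw := one_le_linearWeight w
    have hs1 : δ ≤ √s := Real.sqrt_le_sqrt ((min_le_left _ _).trans hs.1.le)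
    have hs2 : δ ≤ √(q - s) := Real.sqrt_le_sqrt ((min_le_right _ _).trans (by linarith [hs.2]))
    have hs1' : √s ≤ √q := Real.sqrt_le_sqrt (by linarith [hs.2, ht.2])
    have hs2' : √(q - s) ≤ √q := Real.sqrt_le_sqrt (by linarith [hs.1, ht.1])
    have h1 := abs_mul_add_mul_fst_le (1 / √s) (-(1 / √(q - s))) w
    have h1' : |1 / √s| + |-(1 / √(q - s))| ≤ |1 / δ| + |1 / δ| := by
      rw [abs_neg, abs_of_nonneg (by positivity), abs_of_nonneg (by positivity),
        abs_of_nonneg (by positivity)]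
      gcongr
    have h2 := hgK' (√s * w.1 + √(q - s) * w.2.1)
    have hm : |√s| + |√(q - s)| ≤ √q + √q := by
      rw [abs_of_nonneg (Real.sqrt_nonneg _), abs_of_nonneg (Real.sqrt_nonneg _)]
      exact add_le_add hs1' hs2'
    have h3 := abs_comp_le_linearWeight hK hgK
      ((abs_mul_add_mul_snd_le (√s) (√(q - s)) w).trans
        (mul_le_mul_of_nonneg_right hm (by linarith)))
    have e : w.1 / √s - w.2.1 / √(q - s) = 1 / √s * w.1 + -(1 / √(q - s)) * w.2.1 := by ring
    simp only [hP]
    rw [e, abs_mul, abs_mul]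
    calc _ ≤ ((|1 / δ| + |1 / δ|) * linearWeight w) *
          (K * (K * (1 + (√q + √q)) * linearWeight w)) := by
          gcongr
          exact h1.trans (by gcongr)
      _ = _ := by rw [hM]; ring
  have htI : t ∈ Set.Ioo (t / 2) ((t + q) / 2) := ⟨by linarith [ht.1], by linarith [ht.2]⟩
  have hwT (w : ℝ × ℝ × ℝ) : linearWeight (T w) = linearWeight w := by
    simp only [hT, linearWeight]; ring
  have hPi : Integrable (P t) stdGauss₃ :=
    integrable_of_le_linearWeight_sq (hPc t) M (hbound t htI)
  have hPTi : Integrable (fun w => P t (T w)) stdGauss₃ :=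
    measurePreserving_swap_snd.integrable_comp_of_integrable hPi
  have hFi : Integrable (fun w : ℝ × ℝ × ℝ => g (√t * w.1 + √(q - t) * w.2.1) *
      g (√t * w.1 + √(q - t) * w.2.2)) stdGauss₃ := by
    set m := K * (1 + (|√t| + |√(q - t)|))
    refine integrable_of_le_linearWeight_sq (by fun_prop) (m * m) fun w => ?_
    have hw := one_le_linearWeight w
    have h1 := abs_comp_le_linearWeight hK hgK (abs_mul_add_mul_fst_le (√t) (√(q - t)) w)
    have h2 := abs_comp_le_linearWeight hK hgK (abs_mul_add_mul_snd_le (√t) (√(q - t)) w)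
    rw [abs_mul]
    calc _ ≤ (m * linearWeight w) * (m * linearWeight w) := by gcongr
      _ = _ := by ring
  have hD := (hasDerivAt_integral_of_dominated_loc_of_deriv_le (μ := stdGauss₃)
    (F := fun s (w : ℝ × ℝ × ℝ) => g (√s * w.1 + √(q - s) * w.2.1) *
      g (√s * w.1 + √(q - s) * w.2.2))
    (F' := fun s w => (P s w + P s (T w)) / 2)
    (bound := fun w => M * linearWeight w ^ 2)
    (Ioo_mem_nhds htI.1 htI.2)
    (Filter.Eventually.of_forall fun s => (by fun_prop : Continuous _).aestronglyMeasurable)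
    hFi
    (by fun_prop : Continuous _).aestronglyMeasurable
    (ae_of_all _ fun w s hs => ?_) (integrable_linearWeight_sq.const_mul M)
    (ae_of_all _ fun w s hs => ?_)).2
  · refine (hD.const_mul α).congr_deriv ?_
    unfold psi
    rw [integral_div, integral_add hPi hPTi, hTP, hparts]
    ring
  · have h1 := hbound s hs w
    have h2 := hbound s hs (T w)
    rw [hwT] at h2
    rw [Real.norm_eq_abs, abs_div, abs_two]
    have := abs_add_le (P s w) (P s (T w))
    linarith
  · have hs' : s ∈ Set.Ioo 0 q := ⟨by linarith [hs.1, ht.1], by linarith [hs.2, ht.2]⟩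
    have h1 := (hgd _).hasDerivAt.comp s (hasDerivAt_sqrt_mul_add_sqrt_sub_mul hs' w.1 w.2.1)
    have h2 := (hgd _).hasDerivAt.comp s (hasDerivAt_sqrt_mul_add_sqrt_sub_mul hs' w.1 w.2.2)
    refine (h1.mul h2).congr_deriv ?_
    simp only [hP, hT, Function.comp]
    ring

/-- part of Lemma 3.3: if `f` is `C²` with bounded `f′, f″`, then `ψ` is
twice differentiable on `(0, q̲)` with `ψ′(t) = α·E[f′(⋯Z′)·f′(⋯Z″)]` and
`ψ″(t) = α·E[f″(⋯Z′)·f″(⋯Z″)]`; both are nonnegative, so `ψ` is non-decreasing and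
convex on `[0, q̲]`. -/
theorem statement_6 (qlow α : ℝ) (hq : qlow ∈ Set.Ioc (0 : ℝ) 1) (hα : 0 < α)
    (f : ℝ → ℝ) (hf : ContDiff ℝ 2 f)
    (hf' : ∃ C, ∀ x, |deriv f x| ≤ C)
    (hf'' : ∃ C, ∀ x, |deriv (deriv f) x| ≤ C) :
    (∀ t ∈ Set.Ioo (0 : ℝ) qlow,
      HasDerivAt (psi qlow α f) (psi qlow α (deriv f) t) t ∧
      HasDerivAt (deriv (psi qlow α f)) (psi qlow α (deriv (deriv f)) t) t ∧
      0 ≤ psi qlow α (deriv f) t ∧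
      0 ≤ psi qlow α (deriv (deriv f)) t) ∧
    MonotoneOn (psi qlow α f) (Set.Icc 0 qlow) ∧
    ConvexOn ℝ (Set.Icc 0 qlow) (psi qlow α f) := by
  have hf1 : ContDiff ℝ 1 f := hf.of_le one_le_two
  have hdf : ContDiff ℝ 1 (deriv f) := ((contDiff_succ_iff_deriv (n := 1)).1 hf).2.2
  have hddc : Continuous (deriv (deriv f)) := hdf.continuous_deriv le_rfl
  have h1 : ∀ t ∈ Set.Ioo 0 qlow, HasDerivAt (psi qlow α f) (psi qlow α (deriv f) t) t :=
    fun t ht => psi_hasDerivAt hf1 hf' ht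
  have h2 : ∀ t ∈ Set.Ioo 0 qlow,
      HasDerivAt (deriv (psi qlow α f)) (psi qlow α (deriv (deriv f)) t) t := by
    intro t ht
    refine (psi_hasDerivAt hdf hf'' ht).congr_of_eventuallyEq ?_
    filter_upwards [Ioo_mem_nhds ht.1 ht.2] with s hs using (h1 s hs).deriv
  have h3 : ∀ t, 0 ≤ psi qlow α (deriv f) t := psi_nonneg hα.le hdf.continuous hf'
  have h4 : ∀ t, 0 ≤ psi qlow α (deriv (deriv f)) t := psi_nonneg hα.le hddc hf''
  have hc := psi_continuousOn (q := qlow) (α := α) (hf1.differentiable one_ne_zero) hf'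
  refine ⟨fun t ht => ⟨h1 t ht, h2 t ht, h3 t, h4 t⟩, ?_, ?_⟩
  · refine monotoneOn_of_deriv_nonneg (convex_Icc _ _) hc ?_ ?_ <;> rw [interior_Icc]
    · exact fun t ht => (h1 t ht).differentiableAt.differentiableWithinAt
    · exact fun t ht => (h1 t ht).deriv ▸ h3 t
  · refine convexOn_of_deriv2_nonneg (convex_Icc _ _) hc ?_ ?_ ?_ <;> rw [interior_Icc]
    · exact fun t ht => (h1 t ht).differentiableAt.differentiableWithinAt
    · exact fun t ht => (h2 t ht).differentiableAt.differentiableWithinAt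
    · exact fun t ht => (h4 t).trans_eq (h2 t ht).deriv.symm
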